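/- Let φ be a flow on a generalized Peano continuum M and let U be a nonempty, compact, connected, positively invariant subset of M such that every compact minimal set contained in U is hyper-stable. If x ∈ U and x ∉ ω(x), then there exists T ≤ 0 such that φ(t,x) ∉ U for all t < T and φ(t,x) ∈ U for all t ≥ T; in particular the negative orbit {φ(t,x) : t ≤ 0} is not contained in U. -/

import Mathlib

open Set Filter Topology Metric TopologicalSpace

variable {M : Type*} [MetricSpace M]

/-- A set is invariant under the flow `φ`. -/
def IsFlowInvariant (φ : ℝ → M → M) (K : Set M) : Prop :=
  ∀ x ∈ K, ∀ t : ℝ, φ t x ∈ K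

/-- A set is positively invariant under the flow `φ`. -/
def IsPosInvariant (φ : ℝ → M → M) (K : Set M) : Prop :=
  ∀ x ∈ K, ∀ t : ℝ, 0 ≤ t → φ t x ∈ K

/-- A compact minimal set: nonempty, compact, invariant, with no nonempty proper
closed invariant subset. -/
def IsCompactMinimalSet (φ : ℝ → M → M) (K : Set M) : Prop :=
  K.Nonempty ∧ IsCompact K ∧ IsFlowInvariant φ K ∧
    ∀ K' ⊆ K, K'.Nonempty → IsClosed K' → IsFlowInvariant φ K' → K' = K

/-- Lyapunov stability: every neighborhood of `K` contains a positively invariant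
neighborhood of `K`. -/
def IsLyapunovStable (φ : ℝ → M → M) (K : Set M) : Prop :=
  ∀ U ∈ 𝓝ˢ K, ∃ V ∈ 𝓝ˢ K, V ⊆ U ∧ IsPosInvariant φ V

/-- The ω-limit set of a point. -/
def omegaLimitSet (φ : ℝ → M → M) (x : M) : Set M :=
  ⋂ T ∈ Ici (0 : ℝ), closure ((fun t => φ t x) '' Ici T)

/-- The α-limit set of a point. -/
def alphaLimitSet (φ : ℝ → M → M) (x : M) : Set M :=
  ⋂ T ∈ Iic (0 : ℝ), closure ((fun t => φ t x) '' Iic T)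

/-- A compact minimal set is hyper-stable if some neighborhood of it in `M` meets no
Lyapunov unstable compact minimal set. -/
def IsHyperStable (φ : ℝ → M → M) (Λ : Set M) : Prop :=
  IsCompactMinimalSet φ Λ ∧ ∃ W ∈ 𝓝ˢ Λ, ∀ Γ : Set M,
    IsCompactMinimalSet φ Γ → ¬ IsLyapunovStable φ Γ → Γ ∩ W = ∅

/-- A nonempty compact invariant set contains a compact minimal set. -/
lemma exists_isCompactMinimalSet_subset {φ : ℝ → M → M} {K : Set M} (hne : K.Nonempty)
    (hK : IsCompact K) (hinv : IsFlowInvariant φ K) :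
    ∃ Γ ⊆ K, IsCompactMinimalSet φ Γ := by
  obtain ⟨Γ, hΓK, hΓ⟩ := zorn_superset_nonempty
    {A : Set M | A.Nonempty ∧ IsCompact A ∧ IsFlowInvariant φ A} (by
      intro c hc hchain hcne
      have : Nonempty c := hcne.to_subtype
      refine ⟨⋂₀ c, ⟨?_, ?_, ?_⟩, fun s hs => sInter_subset_of_mem hs⟩
      · exact IsCompact.nonempty_sInter_of_directed_nonempty_isCompact_isClosed
          (fun A hA B hB => (hchain.total hA hB).elim
            (fun h => ⟨A, hA, Subset.rfl, h⟩) fun h => ⟨B, hB, h, Subset.rfl⟩)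
          (fun A hA => (hc hA).1) (fun A hA => (hc hA).2.1)
          (fun A hA => (hc hA).2.1.isClosed)
      · obtain ⟨A, hA⟩ := hcne
        exact (hc hA).2.1.of_isClosed_subset
          (isClosed_sInter fun B hB => (hc hB).2.1.isClosed) (sInter_subset_of_mem hA)
      · exact fun y hy t A hA => (hc hA).2.2 y (hy A hA) t) K ⟨hne, hK, hinv⟩
  refine ⟨Γ, hΓK, hΓ.prop.1, hΓ.prop.2.1, hΓ.prop.2.2, fun A hAΓ hAne hAcl hAinv => ?_⟩
  exact hAΓ.antisymm
    (hΓ.le_of_le ⟨hAne, hΓ.prop.2.1.of_isClosed_subset hAcl hAΓ, hAinv⟩ hAΓ)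

/-- A point of a compact minimal set belongs to its own ω-limit set. -/
lemma IsCompactMinimalSet.mem_omegaLimitSet {ϕ : Flow ℝ M} {Γ : Set M}
    (hΓ : IsCompactMinimalSet ϕ Γ) {x : M} (hx : x ∈ Γ) : x ∈ omegaLimitSet ϕ x := by
  obtain ⟨-, hcomp, hinv, hmin⟩ := hΓ
  have hsub : closure (image2 ϕ univ {x}) ⊆ Γ := by
    refine closure_minimal ?_ hcomp.isClosed
    rintro _ ⟨t, -, y, rfl, rfl⟩
    exact hinv y hx t
  have heq : omegaLimit atTop ϕ {x} = Γ := by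
    refine hmin _ ((omegaLimit_subset_closure_image2 _ _ _ univ_mem).trans hsub) ?_
      (isClosed_omegaLimit _ _ _) fun y hy t => ?_
    · exact nonempty_omegaLimit_of_isCompact_absorbing _ _ _ hcomp ⟨univ, univ_mem, hsub⟩
        (singleton_nonempty x)
    · exact Flow.isInvariant_omegaLimit _ ϕ _ (fun s => tendsto_atTop_add_const_left _ s tendsto_id)
        t hy
  refine mem_iInter₂.2 fun T _ => ?_
  have hxT := omegaLimit_subset_closure_image2 _ ϕ _ (Ici_mem_atTop T) (heq.symm ▸ hx)
  rwa [image2_singleton_right] at hxT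

/-- A Lyapunov stable set that the backward orbit of `x` accumulates on contains `x`. -/
lemma IsLyapunovStable.mem_of_mapClusterPt_atBot {ϕ : Flow ℝ M} {Γ : Set M}
    (hstable : IsLyapunovStable ϕ Γ) {x y : M} (hy : y ∈ Γ)
    (hxy : MapClusterPt y atBot fun t => ϕ t x) : x ∈ Γ := by
  by_contra hx
  obtain ⟨V, hV, hVsub, hVpos⟩ := hstable {x}ᶜ
    (isOpen_compl_singleton.mem_nhdsSet.2 (subset_compl_singleton_iff.2 hx))
  obtain ⟨t, htV, ht⟩ := ((hxy.frequently (nhds_le_nhdsSet hy hV)).and_eventually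
    (eventually_le_atBot 0)).exists
  have hxV := hVpos _ htV (-t) (neg_nonneg.2 ht)
  rw [← ϕ.map_add, neg_add_cancel, ϕ.map_zero_apply] at hxV
  exact hVsub hxV rfl

/-- If the backward orbit of `x` stays in a compact set all of whose compact minimal subsets are
Lyapunov stable, then `x` belongs to its own ω-limit set. -/
lemma mem_omegaLimitSet_of_backward_orbit_subset {ϕ : Flow ℝ M} {U : Set M} (hU : IsCompact U)
    (hmin : ∀ Γ ⊆ U, IsCompactMinimalSet ϕ Γ → IsLyapunovStable ϕ Γ) {x : M}
    (hx : (fun t => ϕ t x) '' Iic (0 : ℝ) ⊆ U) : x ∈ omegaLimitSet ϕ x := by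
  have hsub : closure (image2 ϕ (Iic 0) {x}) ⊆ U := by
    rw [image2_singleton_right]
    exact closure_minimal hx hU.isClosed
  have hαU : omegaLimit atBot ϕ {x} ⊆ U :=
    (omegaLimit_subset_closure_image2 _ _ _ (Iic_mem_atBot 0)).trans hsub
  obtain ⟨Γ, hΓα, hΓ⟩ := exists_isCompactMinimalSet_subset (φ := ϕ)
    (nonempty_omegaLimit_of_isCompact_absorbing _ _ _ hU ⟨_, Iic_mem_atBot 0, hsub⟩
      (singleton_nonempty x))
    (hU.of_isClosed_subset (isClosed_omegaLimit _ _ _) hαU)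
    (fun y hy t => Flow.isInvariant_omegaLimit _ ϕ _
      (fun s => tendsto_atBot_add_const_left _ s tendsto_id) t hy)
  obtain ⟨y, hy⟩ := hΓ.1
  exact hΓ.mem_omegaLimitSet <| (hmin Γ (hΓα.trans hαU) hΓ).mem_of_mapClusterPt_atBot hy
    ((mem_omegaLimit_singleton_iff_mapClusterPt _ _ _ _).1 (hΓα hy))

/-- A hyper-stable compact minimal set is Lyapunov stable. -/
lemma IsHyperStable.isLyapunovStable {φ : ℝ → M → M} {Γ : Set M} (h : IsHyperStable φ Γ) :
    IsLyapunovStable φ Γ := by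
  obtain ⟨hΓ, W, hW, hdisj⟩ := h
  by_contra hunstable
  obtain ⟨y, hy⟩ := hΓ.1
  exact (hdisj Γ hΓ hunstable).subset ⟨hy, subset_of_mem_nhdsSet hW hy⟩

/-- A backward orbit leaving a closed positively invariant set does so at a definite time. -/
lemma IsPosInvariant.exists_entry_time {ϕ : Flow ℝ M} {U : Set M} (hpos : IsPosInvariant ϕ U)
    (hclosed : IsClosed U) {x : M} (hx : x ∈ U)
    (hout : ¬ ((fun t => ϕ t x) '' Iic (0 : ℝ) ⊆ U)) :
    ∃ T ≤ (0 : ℝ), (∀ t < T, ϕ t x ∉ U) ∧ ∀ t ≥ T, ϕ t x ∈ U := by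
  have hup : ∀ s t, s ≤ t → ϕ s x ∈ U → ϕ t x ∈ U := fun s t hst hs => by
    simpa [← ϕ.map_add] using hpos _ hs (t - s) (sub_nonneg.2 hst)
  obtain ⟨_, ⟨s, -, rfl⟩, hs⟩ := not_subset.1 hout
  have hbdd : BddBelow {t | ϕ t x ∈ U} :=
    ⟨s, fun t ht => le_of_not_ge fun hts => hs (hup t s hts ht)⟩
  have h0 : (0 : ℝ) ∈ {t | ϕ t x ∈ U} := by simpa using hx
  have hT := (hclosed.preimage (ϕ.continuous continuous_id continuous_const)).csInf_mem
    ⟨0, h0⟩ hbdd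
  exact ⟨_, csInf_le hbdd h0, fun t ht hmem => (csInf_le hbdd hmem).not_gt ht,
    fun t ht => hup _ t ht hT⟩

theorem negative_orbit_escapes_U [LocallyCompactSpace M] [ConnectedSpace M] [LocallyConnectedSpace M]
    (φ : ℝ → M → M)
    (hφcont : Continuous fun p : ℝ × M => φ p.1 p.2)
    (hφzero : ∀ x : M, φ 0 x = x)
    (hφadd : ∀ s t : ℝ, ∀ x : M, φ s (φ t x) = φ (s + t) x)
    (U : Set M) (hUne : U.Nonempty) (hUcomp : IsCompact U) (hUconn : IsConnected U)
    (hUpos : IsPosInvariant φ U)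
    (hmin : ∀ Γ : Set M, Γ ⊆ U → IsCompactMinimalSet φ Γ → IsHyperStable φ Γ)
    (x : M) (hx : x ∈ U) (hxω : x ∉ omegaLimitSet φ x) :
    (∃ T ≤ (0 : ℝ), (∀ t < T, φ t x ∉ U) ∧ ∀ t ≥ T, φ t x ∈ U) ∧
      ¬ ((fun t => φ t x) '' Iic (0 : ℝ) ⊆ U) := by
  let ϕ : Flow ℝ M := ⟨φ, hφcont, fun s t y => (hφadd s t y).symm, hφzero⟩
  have hout : ¬ ((fun t => φ t x) '' Iic (0 : ℝ) ⊆ U) := fun hsub =>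
    hxω <| mem_omegaLimitSet_of_backward_orbit_subset (ϕ := ϕ) hUcomp
      (fun Γ hΓU hΓ => (hmin Γ hΓU hΓ).isLyapunovStable) hsub
  exact ⟨IsPosInvariant.exists_entry_time (ϕ := ϕ) hUpos hUcomp.isClosed hx hout, hout⟩
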